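/- arXiv:2502.17349 — 2 statements merged into one kernel-verified Lean document; each statement's English description precedes it below -/
import Mathlib

section
/- (Theorem D.1, LinkerDPS approximation error bound.) Fix N ≥ 1, a set A of unordered pairs {i, j} of distinct indices in {1, …, N} (each bond counted once), a reference configuration R̃ ∈ (ℝ³)^N, and constants Z, σ₁, σ₂ > 0. Define f : (ℝ³)^N → ℝ by f(r) = (1/Z)·exp(−(φ₁(r)/(2σ₁²) + φ₂(r)/σ₂)), where φ₁(r) = ‖R̃ − r‖² and φ₂(r) = Σ_{{i,j}∈A} ‖r_i − r_j‖, with (ℝ³)^N carrying the Euclidean norm ‖r‖² = Σ_i ‖r_i‖². Let r₀ be an integrable random variable with values in (ℝ³)^N, let r̂ = E[r₀] be its mean, and set m₁ = E[‖r₀ − r̂‖], assumed finite. Then the Jensen gap satisfies |E[f(r₀)] − f(r̂)| ≤ L·m₁, where L = (1/Z)·(e^{−1/2}/σ₁ + N^{3/2}/σ₂). -/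
open MeasureTheory

/-- The configuration space of `N` atoms in `ℝ³`, equipped with the Euclidean
norm `‖r‖² = Σ i, ‖r i‖²`. -/
abbrev Config (N : ℕ) : Type := PiLp 2 (fun _ : Fin N => EuclideanSpace ℝ (Fin 3))


lemma aux_gauss (σ : ℝ) (hσ : 0 < σ) (s t : ℝ) :
    |Real.exp (-(s ^ 2 / (2 * σ ^ 2))) - Real.exp (-(t ^ 2 / (2 * σ ^ 2)))|
      ≤ Real.exp (-1 / 2) / σ * |s - t| := by
  have hd : ∀ x ∈ (Set.univ : Set ℝ), HasDerivWithinAt (fun x : ℝ => Real.exp (-(x ^ 2 / (2 * σ ^ 2))))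
      (Real.exp (-(x ^ 2 / (2 * σ ^ 2))) * (-(2 * x / (2 * σ ^ 2)))) Set.univ x := by
    intro x _
    have h := (((hasDerivAt_pow 2 x).div_const (2 * σ ^ 2)).neg.exp)
    refine HasDerivAt.hasDerivWithinAt ?_
    simpa using h
  have hb : ∀ x ∈ (Set.univ : Set ℝ),
      ‖Real.exp (-(x ^ 2 / (2 * σ ^ 2))) * (-(2 * x / (2 * σ ^ 2)))‖ ≤ Real.exp (-1 / 2) / σ := by
    intro x _
    rw [norm_mul, norm_neg, Real.norm_eq_abs, Real.norm_eq_abs, Real.abs_exp]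
    have e1 : |2 * x / (2 * σ ^ 2)| = (|x| / σ) / σ := by
      rw [mul_div_mul_left _ _ (two_ne_zero), abs_div, abs_of_pos (pow_pos hσ 2)]
      field_simp
    have e2 : x ^ 2 / (2 * σ ^ 2) = (|x| / σ) ^ 2 / 2 := by
      rw [div_pow, sq_abs]; field_simp
    rw [e1, e2, ← mul_div_assoc]
    gcongr
    generalize |x| / σ = y
    have h1 : y ≤ Real.exp (y ^ 2 / 2 - 1 / 2) := by
      have := Real.add_one_le_exp (y ^ 2 / 2 - 1 / 2)
      nlinarith [sq_nonneg (y - 1)]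
    calc Real.exp (-(y ^ 2 / 2)) * y
        ≤ Real.exp (-(y ^ 2 / 2)) * Real.exp (y ^ 2 / 2 - 1 / 2) := by gcongr
      _ = Real.exp (-1 / 2) := by rw [← Real.exp_add]; congr 1; ring
  have := convex_univ.norm_image_sub_le_of_norm_hasDerivWithin_le hd hb
    (Set.mem_univ t) (Set.mem_univ s)
  simpa [Real.norm_eq_abs] using this

lemma aux_exp (a b : ℝ) (ha : 0 ≤ a) (hb : 0 ≤ b) :
    |Real.exp (-a) - Real.exp (-b)| ≤ |a - b| := by
  have key : ∀ a b : ℝ, 0 ≤ a → a ≤ b → Real.exp (-a) - Real.exp (-b) ≤ b - a := by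
    intro a b ha hab
    have h1 : Real.exp (-b) = Real.exp (-a) * Real.exp (a - b) := by
      rw [← Real.exp_add]; congr 1; ring
    have h2 := Real.add_one_le_exp (a - b)
    have h3 : Real.exp (-a) ≤ 1 := Real.exp_le_one_iff.2 (by linarith)
    have h4 := Real.exp_pos (-a)
    nlinarith
  rcases le_total a b with h | h
  · rw [abs_of_nonneg (sub_nonneg.2 (Real.exp_le_exp.2 (by linarith))), abs_sub_comm,
      abs_of_nonneg (sub_nonneg.2 h)]
    exact key a b ha h
  · rw [abs_sub_comm, abs_of_nonneg (sub_nonneg.2 (Real.exp_le_exp.2 (by linarith))),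
      abs_of_nonneg (sub_nonneg.2 h)]
    exact key b a hb h

lemma aux_comb {N : ℕ} (A : Finset (Fin N × Fin N)) (hA : ∀ p ∈ A, p.1 < p.2)
    (a : Fin N → ℝ) (ha : ∀ i, 0 ≤ a i) :
    ∑ p ∈ A, (a p.1 + a p.2) ≤ N * ∑ i, a i := by
  classical
  set B := A.map (Equiv.prodComm (Fin N) (Fin N)).toEmbedding with hB
  have e : ∑ p ∈ A, a p.2 = ∑ p ∈ B, a p.1 := by simp [hB]
  have hdis : Disjoint A B := by
    rw [Finset.disjoint_left]
    intro p hp hp'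
    simp only [hB, Finset.mem_map] at hp'
    obtain ⟨q, hq, rfl⟩ := hp'
    exact absurd (hA _ hp) (not_lt.2 (hA _ hq).le)
  rw [Finset.sum_add_distrib, e, ← Finset.sum_union hdis]
  calc ∑ p ∈ A ∪ B, a p.1 ≤ ∑ p : Fin N × Fin N, a p.1 :=
        Finset.sum_le_sum_of_subset_of_nonneg (Finset.subset_univ _) (fun p _ _ => ha _)
    _ = N * ∑ i, a i := by
        rw [Fintype.sum_prod_type]; simp [Finset.mul_sum]

lemma aux_cs {N : ℕ} (d : Config N) : ∑ i, ‖d i‖ ≤ Real.sqrt N * ‖d‖ := by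
  rw [PiLp.norm_eq_of_L2, ← Real.sqrt_mul (Nat.cast_nonneg N)]
  apply Real.le_sqrt_of_sq_le
  simpa using sq_sum_le_card_mul_sum_sq (s := Finset.univ) (f := fun i => ‖d i‖)

lemma aux_phi {N : ℕ} (hN : 1 ≤ N) (A : Finset (Fin N × Fin N)) (hA : ∀ p ∈ A, p.1 < p.2)
    (r s : Config N) :
    |∑ p ∈ A, ‖r p.1 - r p.2‖ - ∑ p ∈ A, ‖s p.1 - s p.2‖| ≤
      (N : ℝ) ^ ((3 : ℝ) / 2) * ‖r - s‖ := by
  have hpos : (0 : ℝ) < N := by exact_mod_cast hN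
  rw [← Finset.sum_sub_distrib]
  calc _ ≤ ∑ p ∈ A, |‖r p.1 - r p.2‖ - ‖s p.1 - s p.2‖| := Finset.abs_sum_le_sum_abs _ _
    _ ≤ ∑ p ∈ A, (‖(r - s) p.1‖ + ‖(r - s) p.2‖) := by
        apply Finset.sum_le_sum
        intro p _
        refine (abs_norm_sub_norm_le _ _).trans ?_
        have : r p.1 - r p.2 - (s p.1 - s p.2) = (r - s) p.1 - (r - s) p.2 := by
          simp only [PiLp.sub_apply]; abel
        rw [this]
        exact norm_sub_le _ _
    _ ≤ N * ∑ i, ‖(r - s) i‖ := aux_comb A hA (fun i => ‖(r - s) i‖) (fun i => norm_nonneg _)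
    _ ≤ N * (Real.sqrt N * ‖r - s‖) := by gcongr; exact aux_cs _
    _ = _ := by
        rw [show (3 : ℝ) / 2 = 1 + 1 / 2 by norm_num, Real.rpow_add hpos, Real.rpow_one,
          ← Real.sqrt_eq_rpow]; ring

lemma aux_lip {N : ℕ} (hN : 1 ≤ N) (A : Finset (Fin N × Fin N)) (hA : ∀ p ∈ A, p.1 < p.2)
    (R : Config N) (Z σ₁ σ₂ : ℝ) (hZ : 0 < Z) (hσ₁ : 0 < σ₁) (hσ₂ : 0 < σ₂) (r s : Config N) :
    |(1 / Z) * Real.exp (-(‖R - r‖ ^ 2 / (2 * σ₁ ^ 2) + (∑ p ∈ A, ‖r p.1 - r p.2‖) / σ₂))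
      - (1 / Z) * Real.exp (-(‖R - s‖ ^ 2 / (2 * σ₁ ^ 2) + (∑ p ∈ A, ‖s p.1 - s p.2‖) / σ₂))|
      ≤ (1 / Z) * (Real.exp (-1 / 2) / σ₁ + (N : ℝ) ^ ((3 : ℝ) / 2) / σ₂) * ‖r - s‖ := by
  rw [← mul_sub, abs_mul, abs_of_pos (one_div_pos.2 hZ), mul_assoc]
  gcongr
  have hP : ∀ r : Config N, 0 ≤ (∑ p ∈ A, ‖r p.1 - r p.2‖) / σ₂ := fun r => by positivity
  have hg := aux_gauss σ₁ hσ₁ ‖R - r‖ ‖R - s‖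
  have hh := aux_exp _ _ (hP r) (hP s)
  have hn : |‖R - r‖ - ‖R - s‖| ≤ ‖r - s‖ := by
    refine (abs_norm_sub_norm_le _ _).trans ?_
    rw [sub_sub_sub_cancel_left, norm_sub_rev]
  rw [← sub_div, abs_div, abs_of_pos hσ₂] at hh
  have hh2 := hh.trans (div_le_div_of_nonneg_right (aux_phi hN A hA r s) hσ₂.le)
  have hg2 := hg.trans (mul_le_mul_of_nonneg_left hn (by positivity))
  rw [neg_add, neg_add, Real.exp_add, Real.exp_add]
  have b1 : Real.exp (-((∑ p ∈ A, ‖r p.1 - r p.2‖) / σ₂)) ≤ 1 :=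
    Real.exp_le_one_iff.2 (by linarith [hP r])
  have b2 : Real.exp (-(‖R - s‖ ^ 2 / (2 * σ₁ ^ 2))) ≤ 1 :=
    Real.exp_le_one_iff.2 (neg_nonpos.2 (by positivity))
  have p1 := Real.exp_pos (-((∑ p ∈ A, ‖r p.1 - r p.2‖) / σ₂))
  have p2 := Real.exp_pos (-(‖R - s‖ ^ 2 / (2 * σ₁ ^ 2)))
  generalize Real.exp (-((∑ p ∈ A, ‖r p.1 - r p.2‖) / σ₂)) = h at *
  generalize Real.exp (-((∑ p ∈ A, ‖s p.1 - s p.2‖) / σ₂)) = h' at *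
  generalize Real.exp (-(‖R - s‖ ^ 2 / (2 * σ₁ ^ 2))) = g' at *
  generalize Real.exp (-(‖R - r‖ ^ 2 / (2 * σ₁ ^ 2))) = g at *
  calc |g * h - g' * h'| = |(g - g') * h + g' * (h - h')| := by congr 1; ring
    _ ≤ |(g - g') * h| + |g' * (h - h')| := abs_add_le _ _
    _ = |g - g'| * h + g' * |h - h'| := by rw [abs_mul, abs_mul, abs_of_pos p1, abs_of_pos p2]
    _ ≤ |g - g'| + |h - h'| := add_le_add (mul_le_of_le_one_right (abs_nonneg _) b1)
        (mul_le_of_le_one_left (abs_nonneg _) b2)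
    _ ≤ _ := (add_le_add hg2 hh2).trans (le_of_eq (by ring))

/-- Theorem D.1 (LinkerDPS approximation error bound).  For the cross-domain
likelihood `f r = (1/Z) * exp (-(‖R̃ - r‖² / (2σ₁²) + φ₂ r / σ₂))`, with
`φ₂ r = Σ_{{i,j} ∈ A} ‖r i - r j‖` (each unordered bond `{i,j}`, `i < j`,
counted once), and an integrable random configuration `r₀` with mean
`r̂ = E[r₀]` and finite first absolute centered moment `m₁ = E[‖r₀ - r̂‖]`,
the Jensen gap satisfies `|E[f(r₀)] - f(r̂)| ≤ L * m₁` where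
`L = (1/Z) * (exp (-1/2) / σ₁ + N^(3/2) / σ₂)`. -/
theorem linkerDPS_approximation_error {Ω : Type*} [MeasurableSpace Ω]
    (μ : Measure Ω) [IsProbabilityMeasure μ]
    (N : ℕ) (hN : 1 ≤ N)
    (A : Finset (Fin N × Fin N)) (hA : ∀ p ∈ A, p.1 < p.2)
    (Rtilde : Config N) (Z σ₁ σ₂ : ℝ) (hZ : 0 < Z) (hσ₁ : 0 < σ₁) (hσ₂ : 0 < σ₂)
    (r₀ : Ω → Config N) (hr₀ : Integrable r₀ μ)
    (hm₁ : Integrable (fun ω => ‖r₀ ω - ∫ ω', r₀ ω' ∂μ‖) μ) :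
    |(∫ ω, (1 / Z) * Real.exp (-(‖Rtilde - r₀ ω‖ ^ 2 / (2 * σ₁ ^ 2)
          + (∑ p ∈ A, ‖r₀ ω p.1 - r₀ ω p.2‖) / σ₂)) ∂μ)
      - (1 / Z) * Real.exp (-(‖Rtilde - ∫ ω', r₀ ω' ∂μ‖ ^ 2 / (2 * σ₁ ^ 2)
          + (∑ p ∈ A, ‖(∫ ω', r₀ ω' ∂μ) p.1 - (∫ ω', r₀ ω' ∂μ) p.2‖) / σ₂))|
      ≤ (1 / Z) * (Real.exp (-1 / 2) / σ₁ + (N : ℝ) ^ ((3 : ℝ) / 2) / σ₂)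
          * ∫ ω, ‖r₀ ω - ∫ ω', r₀ ω' ∂μ‖ ∂μ := by
  set m := ∫ ω', r₀ ω' ∂μ with hm
  set f : Config N → ℝ := fun r => (1 / Z) * Real.exp (-(‖Rtilde - r‖ ^ 2 / (2 * σ₁ ^ 2)
          + (∑ p ∈ A, ‖r p.1 - r p.2‖) / σ₂)) with hf
  have hlip : ∀ r, |f r - f m| ≤ _ := fun r =>
    aux_lip hN A hA Rtilde Z σ₁ σ₂ hZ hσ₁ hσ₂ r m
  have hcont : Continuous f := by
    simp only [hf]
    fun_prop
  have hint : Integrable (fun ω => f (r₀ ω)) μ := by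
    refine Integrable.of_bound (hcont.comp_aestronglyMeasurable hr₀.1) (1 / Z) ?_
    refine Filter.Eventually.of_forall fun ω => ?_
    simp only [hf]
    rw [norm_mul, Real.norm_eq_abs, Real.norm_eq_abs, Real.abs_exp,
      abs_of_pos (one_div_pos.2 hZ)]
    refine mul_le_of_le_one_right (by positivity) (Real.exp_le_one_iff.2 (neg_nonpos.2 ?_))
    positivity
  change |∫ ω, f (r₀ ω) ∂μ - f m| ≤ _
  have e : ∫ ω, f (r₀ ω) ∂μ - f m = ∫ ω, (f (r₀ ω) - f m) ∂μ := by
    rw [integral_sub hint (integrable_const _)]; simp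
  rw [e, ← integral_const_mul]
  refine (abs_integral_le_integral_abs).trans ?_
  exact integral_mono (hint.sub (integrable_const _)).abs (hm₁.const_mul _) (fun ω => hlip _)
end

section
/- (DPS Jensen-gap bound for a Gaussian measurement likelihood, with explicit Lipschitz constant.) Let d, n ≥ 1, let A : ℝ^d → ℝ^n be everywhere differentiable with ‖DA(x)‖_op ≤ M for all x ∈ ℝ^d, let y ∈ ℝ^n, and let σ > 0. Define f : ℝ^d → ℝ by f(x) = (2πσ²)^{−n/2}·exp(−‖y − A(x)‖²/(2σ²)). Let X be an integrable random variable with values in ℝ^d, let x̂ = E[X] be its mean, and set m₁ = E[‖X − x̂‖], assumed finite. Then |E[f(X)] − f(x̂)| ≤ (2πσ²)^{−n/2}·(M·e^{−1/2}/σ)·m₁. -/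
open MeasureTheory

lemma gauss_scalar_lip (σ : ℝ) (hσ : 0 < σ) (a b : ℝ) :
    |Real.exp (-a ^ 2 / (2 * σ ^ 2)) - Real.exp (-b ^ 2 / (2 * σ ^ 2))|
      ≤ Real.exp (-1 / 2) / σ * |a - b| := by
  have hd : ∀ r : ℝ, HasDerivAt (fun r : ℝ => Real.exp (-r ^ 2 / (2 * σ ^ 2)))
      (Real.exp (-r ^ 2 / (2 * σ ^ 2)) * (-(2 * r) / (2 * σ ^ 2))) r := by
    intro r
    have h1 : HasDerivAt (fun r : ℝ => -r ^ 2 / (2 * σ ^ 2)) (-(2 * r) / (2 * σ ^ 2)) r := by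
      have := ((hasDerivAt_pow 2 r).neg).div_const (2 * σ ^ 2)
      simpa using this
    exact h1.exp
  have hb : ∀ r : ℝ, ‖Real.exp (-r ^ 2 / (2 * σ ^ 2)) * (-(2 * r) / (2 * σ ^ 2))‖
      ≤ Real.exp (-1 / 2) / σ := by
    intro r
    obtain ⟨t, rfl⟩ : ∃ t, r = σ * t := ⟨r / σ, by field_simp⟩
    have e1 : -(σ * t) ^ 2 / (2 * σ ^ 2) = -1 / 2 + -((t ^ 2 - 1) / 2) := by
      field_simp
      ring
    have e2 : -(2 * (σ * t)) / (2 * σ ^ 2) = -(t / σ) := by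
      field_simp
    rw [e1, e2, Real.exp_add, Real.exp_neg, Real.norm_eq_abs, abs_mul, abs_neg, abs_div,
      abs_of_pos hσ, abs_of_pos (by positivity)]
    have h3 : |t| ≤ Real.exp ((t ^ 2 - 1) / 2) := by
      have := Real.add_one_le_exp ((t ^ 2 - 1) / 2)
      nlinarith [sq_nonneg (|t| - 1), sq_abs t]
    have h4 : (Real.exp ((t ^ 2 - 1) / 2))⁻¹ * |t| ≤ 1 := by
      rw [inv_mul_le_iff₀ (Real.exp_pos _)]
      simpa using h3
    calc _ = Real.exp (-1 / 2) / σ * ((Real.exp ((t ^ 2 - 1) / 2))⁻¹ * |t|) := by ring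
      _ ≤ Real.exp (-1 / 2) / σ * 1 := by gcongr
      _ = _ := mul_one _
  have := convex_univ.norm_image_sub_le_of_norm_hasDerivWithin_le
    (fun r _ => (hd r).hasDerivWithinAt) (fun r _ => hb r) (Set.mem_univ b) (Set.mem_univ a)
  simpa [Real.norm_eq_abs] using this


/-- DPS Jensen-gap bound for the Gaussian measurement likelihood
`f x = (2πσ²)^(-n/2) * exp (-‖y - A x‖² / (2σ²))` with `A : ℝ^d → ℝ^n`
everywhere differentiable and `‖DA x‖ ≤ M` for all `x`.  For an integrable
random variable `X` on `ℝ^d` with mean `x̂ = E[X]` and finite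
`m₁ = E[‖X - x̂‖]`, the Jensen gap satisfies
`|E[f(X)] - f(x̂)| ≤ (2πσ²)^(-n/2) * (M * exp (-1/2) / σ) * m₁`. -/
theorem dps_jensen_gap_bound {Ω : Type*} [MeasurableSpace Ω]
    (μ : Measure Ω) [IsProbabilityMeasure μ]
    (d n : ℕ) (hd : 1 ≤ d) (hn : 1 ≤ n)
    (A : EuclideanSpace ℝ (Fin d) → EuclideanSpace ℝ (Fin n))
    (hA : Differentiable ℝ A) (M : ℝ) (hM : ∀ x, ‖fderiv ℝ A x‖ ≤ M)
    (y : EuclideanSpace ℝ (Fin n)) (σ : ℝ) (hσ : 0 < σ)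
    (X : Ω → EuclideanSpace ℝ (Fin d)) (hX : Integrable X μ)
    (hm₁ : Integrable (fun ω => ‖X ω - ∫ ω', X ω' ∂μ‖) μ) :
    |(∫ ω, (2 * Real.pi * σ ^ 2) ^ (-(n : ℝ) / 2)
          * Real.exp (-‖y - A (X ω)‖ ^ 2 / (2 * σ ^ 2)) ∂μ)
      - (2 * Real.pi * σ ^ 2) ^ (-(n : ℝ) / 2)
          * Real.exp (-‖y - A (∫ ω', X ω' ∂μ)‖ ^ 2 / (2 * σ ^ 2))|
      ≤ (2 * Real.pi * σ ^ 2) ^ (-(n : ℝ) / 2)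
          * (M * Real.exp (-1 / 2) / σ) * ∫ ω, ‖X ω - ∫ ω', X ω' ∂μ‖ ∂μ := by
  set c : ℝ := (2 * Real.pi * σ ^ 2) ^ (-(n : ℝ) / 2) with hc
  have hc0 : 0 ≤ c := by positivity
  set m := ∫ ω', X ω' ∂μ with hm
  have hlip : ∀ x z, ‖A x - A z‖ ≤ M * ‖x - z‖ := fun x z =>
    convex_univ.norm_image_sub_le_of_norm_fderiv_le (𝕜 := ℝ)
      (fun w _ => hA w) (fun w _ => hM w) (Set.mem_univ z) (Set.mem_univ x)
  have key : ∀ x, ‖c * Real.exp (-‖y - A x‖ ^ 2 / (2 * σ ^ 2))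
      - c * Real.exp (-‖y - A m‖ ^ 2 / (2 * σ ^ 2))‖
      ≤ c * (M * Real.exp (-1 / 2) / σ) * ‖x - m‖ := by
    intro x
    rw [← mul_sub, Real.norm_eq_abs, abs_mul, abs_of_nonneg hc0]
    have h1 := gauss_scalar_lip σ hσ ‖y - A x‖ ‖y - A m‖
    have h2 : |‖y - A x‖ - ‖y - A m‖| ≤ M * ‖x - m‖ := by
      refine (abs_norm_sub_norm_le _ _).trans ?_
      rw [sub_sub_sub_cancel_left, norm_sub_rev]
      exact hlip x m
    calc _ ≤ c * (Real.exp (-1 / 2) / σ * (M * ‖x - m‖)) := by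
          gcongr
          exact h1.trans (by gcongr)
      _ = _ := by ring
  have hint : Integrable (fun ω => c * Real.exp (-‖y - A (X ω)‖ ^ 2 / (2 * σ ^ 2))) μ := by
    have hcont : Continuous fun x => c * Real.exp (-‖y - A x‖ ^ 2 / (2 * σ ^ 2)) := by
      have := hA.continuous
      fun_prop
    refine Integrable.of_bound (hcont.comp_aestronglyMeasurable hX.aestronglyMeasurable) c ?_
    refine Filter.Eventually.of_forall fun ω => ?_
    rw [Real.norm_eq_abs, abs_of_nonneg (by positivity)]
    refine mul_le_of_le_one_right hc0 (Real.exp_le_one_iff.2 ?_)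
    rw [neg_div]
    exact neg_nonpos.2 (by positivity)
  have heq : (∫ ω, c * Real.exp (-‖y - A (X ω)‖ ^ 2 / (2 * σ ^ 2)) ∂μ)
      - c * Real.exp (-‖y - A m‖ ^ 2 / (2 * σ ^ 2))
      = ∫ ω, (c * Real.exp (-‖y - A (X ω)‖ ^ 2 / (2 * σ ^ 2))
          - c * Real.exp (-‖y - A m‖ ^ 2 / (2 * σ ^ 2))) ∂μ := by
    rw [integral_sub hint (integrable_const _)]
    simp
  rw [heq, ← Real.norm_eq_abs, ← integral_const_mul]
  exact norm_integral_le_of_norm_le (hm₁.const_mul _)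
    (Filter.Eventually.of_forall fun ω => key (X ω))
end
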